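/- Let A and B be groups and let N be a normal subgroup of the free product A * B such that N ∩ A = {1}, N ∩ B = {1}, and N is nontrivial. Then the minimal free product length of a nontrivial element of N is even. -/

import Mathlib

open Monoid

variable {A B : Type*} [Group A] [Group B]

/-- The free product length of an element of `A ∗ B`: the least number of
letters (each from `A` or `B`) whose product is `x`.  For a nontrivial element
this is the number of syllables in its normal form. -/
noncomputable def fpLength (x : Coprod A B) : ℕ :=
  sInf {n | ∃ l : List (Coprod A B), l.length = n ∧ l.prod = x ∧
      ∀ w ∈ l, (∃ a : A, Coprod.inl a = w) ∨ (∃ b : B, Coprod.inr b = w)}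

/-- The minimal free product length of a nontrivial element of `N`. -/
noncomputable def minRelLength (N : Subgroup (Coprod A B)) : ℕ :=
  sInf (fpLength '' {x | x ∈ N ∧ x ≠ 1})

/-- A letter from `A` or `B`, viewed as an element of `A ∗ B`. -/
def letter : A ⊕ B → Coprod A B :=
  Sum.elim Coprod.inl Coprod.inr

/-- Two letters from the same factor multiply to a letter. -/
lemma exists_letter_eq_mul {s t : A ⊕ B} (h : s.isLeft = t.isLeft) :
    ∃ r : A ⊕ B, letter r = letter s * letter t := by
  rcases s with a | b <;> rcases t with a' | b'
  · exact ⟨Sum.inl (a * a'), map_mul _ _ _⟩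
  · simp at h
  · simp at h
  · exact ⟨Sum.inr (b * b'), map_mul _ _ _⟩

lemma exists_list_letter_prod_eq (x : Coprod A B) :
    ∃ l : List (A ⊕ B), (l.map letter).prod = x := by
  induction x using Coprod.induction_on with
  | inl a => exact ⟨[Sum.inl a], by simp [letter]⟩
  | inr b => exact ⟨[Sum.inr b], by simp [letter]⟩
  | mul x y hx hy =>
    obtain ⟨l, rfl⟩ := hx
    obtain ⟨m, rfl⟩ := hy
    exact ⟨l ++ m, by simp⟩

lemma fpLength_le_length (l : List (A ⊕ B)) : fpLength (l.map letter).prod ≤ l.length := by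
  refine Nat.sInf_le ⟨l.map letter, by simp, rfl, fun w hw => ?_⟩
  obtain ⟨s | s, -, rfl⟩ := List.mem_map.1 hw
  · exact Or.inl ⟨s, rfl⟩
  · exact Or.inr ⟨s, rfl⟩

lemma exists_list_letter_length_eq_fpLength (x : Coprod A B) :
    ∃ l : List (A ⊕ B), (l.map letter).prod = x ∧ l.length = fpLength x := by
  have hne : {n | ∃ l : List (Coprod A B), l.length = n ∧ l.prod = x ∧
      ∀ w ∈ l, (∃ a : A, Coprod.inl a = w) ∨ (∃ b : B, Coprod.inr b = w)}.Nonempty := by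
    obtain ⟨l, hl⟩ := exists_list_letter_prod_eq x
    refine ⟨_, l.map letter, rfl, hl, fun w hw => ?_⟩
    obtain ⟨s | s, -, rfl⟩ := List.mem_map.1 hw
    · exact Or.inl ⟨s, rfl⟩
    · exact Or.inr ⟨s, rfl⟩
  obtain ⟨l, hlen, hprod, hl⟩ := Nat.sInf_mem hne
  obtain ⟨m, rfl⟩ : l ∈ Set.range (List.map (letter (A := A) (B := B))) := by
    rw [Set.range_list_map]
    intro w hw
    rcases hl w hw with ⟨a, rfl⟩ | ⟨b, rfl⟩
    · exact ⟨Sum.inl a, rfl⟩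
    · exact ⟨Sum.inr b, rfl⟩
  exact ⟨m, hprod, by rwa [List.length_map] at hlen⟩

/-- A word either can be shortened, or its letters alternate between the two factors, so that the
parity of its length tells whether its first and last letters lie in the same factor. -/
lemma exists_shorter_or_isLeft_getLast_iff (s : A ⊕ B) (l : List (A ⊕ B)) :
    (∃ m : List (A ⊕ B), m.length < (s :: l).length ∧
      (m.map letter).prod = ((s :: l).map letter).prod) ∨
    (((s :: l).getLast (List.cons_ne_nil s l)).isLeft = s.isLeft ↔ Even l.length) := by
  induction l generalizing s with
  | nil => simp
  | cons t l ih =>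
    rcases ih t with ⟨m, hm, hprod⟩ | h
    · exact Or.inl ⟨s :: m, by simpa using hm, by simp [hprod]⟩
    by_cases hst : s.isLeft = t.isLeft
    · obtain ⟨r, hr⟩ := exists_letter_eq_mul hst
      exact Or.inl ⟨r :: l, by simp, by simp [hr, mul_assoc]⟩
    · right
      rw [List.getLast_cons (List.cons_ne_nil t l), List.length_cons, Nat.even_add_one, ← h]
      generalize ((t :: l).getLast _).isLeft = c
      revert hst
      generalize s.isLeft = a
      generalize t.isLeft = b
      revert a b c
      decide

/-- If `N` is a nontrivial normal subgroup of the free product `A ∗ B`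
meeting each of `A` and `B` trivially, then the minimal free product length of a
nontrivial element of `N` is even. -/
theorem minRelLength_even_of_normal
    (N : Subgroup (Coprod A B)) [N.Normal]
    (hA : ∀ a : A, Coprod.inl a ∈ N → a = 1)
    (hB : ∀ b : B, Coprod.inr b ∈ N → b = 1)
    (hN : N ≠ ⊥) :
    Even (minRelLength N) := by
  obtain ⟨y, hyN, hy⟩ := N.bot_or_exists_ne_one.resolve_left hN
  obtain ⟨x, ⟨hxN, hx⟩, hxlen⟩ := Nat.sInf_mem (s := fpLength '' {x | x ∈ N ∧ x ≠ 1})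
    ⟨_, y, ⟨hyN, hy⟩, rfl⟩
  have hmin (l : List (A ⊕ B)) (hN : (l.map letter).prod ∈ N) (h1 : (l.map letter).prod ≠ 1) :
      fpLength x ≤ l.length := by
    rw [hxlen]
    have hmem : fpLength (l.map letter).prod ∈ fpLength '' {x | x ∈ N ∧ x ≠ 1} :=
      ⟨_, ⟨hN, h1⟩, rfl⟩
    exact (Nat.sInf_le hmem).trans (fpLength_le_length l)
  change Even (sInf _)
  rw [← hxlen]
  obtain ⟨l, rfl, hlen⟩ := exists_list_letter_length_eq_fpLength x
  rw [← hlen] at hmin ⊢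
  rcases l with _ | ⟨s, l⟩
  · simp
  rcases exists_shorter_or_isLeft_getLast_iff s l with ⟨m, hm, hprod⟩ | h
  · exact absurd (hmin m (hprod ▸ hxN) (hprod ▸ hx)) hm.not_ge
  rw [List.length_cons, Nat.even_add_one, ← h]
  intro hlast
  rcases List.eq_nil_or_concat l with rfl | ⟨v, t, rfl⟩
  · rcases s with a | b
    · exact hx (by simp [letter, hA a (by simpa [letter] using hxN)])
    · exact hx (by simp [letter, hB b (by simpa [letter] using hxN)])
  obtain ⟨r, hr⟩ := exists_letter_eq_mul (s := t) (t := s) (by simpa using hlast)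
  have hconj : ((v ++ [r]).map letter).prod =
      (letter s)⁻¹ * ((s :: (v ++ [t])).map letter).prod * (letter s)⁻¹⁻¹ := by
    simp [hr, mul_assoc]
  have := hmin (v ++ [r]) (hconj ▸ ‹N.Normal›.conj_mem _ (by simpa using hxN) _)
    (by rw [hconj, Ne, conj_eq_one_iff]; simpa using hx)
  simp at this
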